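/- arXiv:2512.19345 — 2 statements merged into one kernel-verified Lean document; each statement's English description precedes it below -/
import Mathlib

section
/- Let p be an odd prime and let G be a non-Abelian finite p-group. Then the set of orders of kernels of the non-linear irreducible complex characters of G is exactly {1, p} if and only if G has order p^4 and nilpotency class 3 (i.e., G is of maximal class). -/
open CategoryTheory

/-- The kernel of the character of a complex representation `V` of `G`:
`ker χ = {g ∈ G : χ(g) = χ(1)}`. -/
noncomputable def charKer {G : Type} [Group G] (V : FDRep ℂ G) : Set G :=
  {g | V.character g = V.character 1}

/-- The center of the character of a complex representation `V` of `G`: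
`Z(χ) = {g ∈ G : |χ(g)| = χ(1)}`. -/
noncomputable def charCenter {G : Type} [Group G] (V : FDRep ℂ G) : Set G :=
  {g | (‖V.character g‖ : ℂ) = V.character 1}

open scoped commutatorElement

theorem Multiset.re_sum_le_card (s : Multiset ℂ) (hs : ∀ μ ∈ s, ‖μ‖ ≤ 1) :
    s.sum.re ≤ s.card := by
  induction s using Multiset.induction with
  | empty => simp
  | cons a t ih =>
    have h1 := ih fun μ hμ => hs μ (Multiset.mem_cons_of_mem hμ)
    have h2 := (Complex.re_le_norm a).trans (hs a (Multiset.mem_cons_self a t))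
    simp only [Multiset.sum_cons, Complex.add_re, Multiset.card_cons, Nat.cast_add, Nat.cast_one]
    linarith

theorem Multiset.eq_one_of_sum_eq_card (s : Multiset ℂ) (hs : ∀ μ ∈ s, ‖μ‖ ≤ 1)
    (hsum : s.sum = s.card) : ∀ μ ∈ s, μ = 1 := by
  intro μ hμ
  obtain ⟨t, rfl⟩ := Multiset.exists_cons_of_mem hμ
  have h1 := t.re_sum_le_card fun ν hν => hs ν (Multiset.mem_cons_of_mem hν)
  have h2 := hs μ hμ
  have h3 := congrArg Complex.re hsum
  simp only [Multiset.sum_cons, Complex.add_re, Multiset.card_cons, Complex.natCast_re,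
    Complex.add_re, Complex.one_re, Nat.cast_add, Nat.cast_one] at h3
  have h4 : μ.re = 1 := le_antisymm ((Complex.re_le_norm μ).trans h2) (by linarith)
  have h5 : μ.re ^ 2 + μ.im ^ 2 ≤ 1 := by
    have := Complex.sq_norm μ
    rw [Complex.normSq_apply] at this
    nlinarith [norm_nonneg μ]
  refine Complex.ext h4 ?_
  rw [h4] at h5
  simpa using pow_eq_zero_iff (two_ne_zero) |>.1 (le_antisymm (by linarith) (sq_nonneg μ.im))

/-- An endomorphism of finite order whose trace is the dimension is the identity. -/
theorem LinearMap.eq_one_of_pow_eq_one_of_trace_eq_finrank {V : Type*} [AddCommGroup V]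
    [Module ℂ V] [FiniteDimensional ℂ V] (f : Module.End ℂ V) {m : ℕ} (hm : m ≠ 0)
    (hf : f ^ m = 1) (htr : LinearMap.trace ℂ V f = Module.finrank ℂ V) : f = 1 := by
  have hsplit : f.charpoly.Splits := IsAlgClosed.splits _
  have hcard : f.charpoly.roots.card = Module.finrank ℂ V := by
    rw [← hsplit.natDegree_eq_card_roots, LinearMap.charpoly_natDegree]
  have hnorm : ∀ μ ∈ f.charpoly.roots, ‖μ‖ ≤ 1 := by
    intro μ hμ
    have hev : f.HasEigenvalue μ :=
      (Module.End.hasEigenvalue_iff_isRoot_charpoly f μ).2 (Polynomial.isRoot_of_mem_roots hμ)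
    have h1 := hev.pow m
    rw [hf] at h1
    obtain ⟨v, hv⟩ := h1.exists_hasEigenvector
    have h2 : v = μ ^ m • v := hv.apply_eq_smul
    have h3 : (μ ^ m - 1) • v = 0 := by rw [sub_smul, ← h2, one_smul, sub_self]
    have h4 : μ ^ m = 1 := sub_eq_zero.1 ((smul_eq_zero.1 h3).resolve_right hv.2)
    exact (Complex.norm_eq_one_of_pow_eq_one h4 hm).le
  have hone := Multiset.eq_one_of_sum_eq_card _ hnorm (by
    rw [← Module.End.trace_eq_sum_roots_charpoly_of_splits hsplit, htr, hcard])
  have hchar : f.charpoly = (Polynomial.X - Polynomial.C 1) ^ (Module.finrank ℂ V) := by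
    rw [hsplit.eq_prod_roots_of_monic f.charpoly_monic, Multiset.eq_replicate_of_mem hone, hcard]
    simp
  have hd1 : minpoly ℂ f ∣ (Polynomial.X - Polynomial.C 1) ^ (Module.finrank ℂ V + 1) := by
    rw [pow_succ, ← hchar]
    exact (minpoly.dvd ℂ f f.aeval_self_charpoly).mul_right _
  have hd2 : minpoly ℂ f ∣ Polynomial.X ^ m - Polynomial.C 1 :=
    minpoly.dvd ℂ f (by simp [hf])
  have hsq : Squarefree (minpoly ℂ f) :=
    ((Polynomial.separable_X_pow_sub_C (1 : ℂ) (by exact_mod_cast hm)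
      one_ne_zero).squarefree).squarefree_of_dvd hd2
  have hd3 := (hsq.dvd_pow_iff_dvd (Nat.succ_ne_zero _)).1 hd1
  have := (minpoly.dvd_iff).1 hd3
  simpa [sub_eq_zero] using this

/-- The kernel of the character is the kernel of the representation. -/
theorem charKer_eq_ker {G : Type} [Group G] [Finite G] (V : FDRep ℂ G) :
    charKer V = (V.ρ.ker : Set G) := by
  ext g
  change V.character g = V.character 1 ↔ V.ρ g = 1
  constructor
  · intro h
    rw [FDRep.char_one] at h
    refine LinearMap.eq_one_of_pow_eq_one_of_trace_eq_finrank _ (Nat.card_pos (α := G)).ne' ?_ h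
    rw [← map_pow, pow_card_eq_one', map_one]
  · intro h
    unfold FDRep.character
    rw [h, map_one V.ρ]

/-- The Schur lemma: an endomorphism commuting with a simple representation is a scalar. -/
theorem FDRep.exists_smul_one_of_commute {G : Type} [Group G] (V : FDRep ℂ G) [Simple V]
    (f : Module.End ℂ V) (hf : ∀ g, V.ρ g * f = f * V.ρ g) : ∃ c : ℂ, f = c • 1 := by
  let F : V ⟶ V := ⟨InducedCategory.homMk (ModuleCat.ofHom f), fun g ↦ by
    ext1
    ext v
    exact (LinearMap.congr_fun (hf g) v).symm⟩
  obtain ⟨c, hc⟩ := (finrank_eq_one_iff_of_nonzero' (𝟙 V) (id_nonzero V)).1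
    (finrank_endomorphism_simple_eq_one ℂ V) F
  refine ⟨c, ?_⟩
  ext v
  have := congrArg (fun k : V ⟶ V => k.hom.hom.hom v) hc
  exact this.symm

/-- A simple representation of dimension greater than one is nontrivial on some commutator. -/
theorem FDRep.exists_commutator_notMem_ker {G : Type} [Group G] (V : FDRep ℂ G) [Simple V]
    (hV : 1 < Module.finrank ℂ V) : ∃ a b : G, ⁅a, b⁆ ∉ V.ρ.ker := by
  by_contra! H
  have hcomm : ∀ a b, V.ρ a * V.ρ b = V.ρ b * V.ρ a := by
    intro a b
    have h1 : V.ρ ⁅a, b⁆ = 1 := H a b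
    have h2 : a * b = ⁅a, b⁆ * (b * a) := by rw [commutatorElement_def]; group
    rw [← map_mul, h2, map_mul, h1, one_mul, map_mul]
  have hsc : ∀ a, ∃ c : ℂ, V.ρ a = c • 1 := fun a =>
    V.exists_smul_one_of_commute (V.ρ a) fun g => hcomm g a
  have hall : ∀ f : Module.End ℂ V, ∃ c : ℂ, f = c • 1 := fun f =>
    V.exists_smul_one_of_commute f fun g => by
      obtain ⟨c, hc⟩ := hsc g
      rw [hc, smul_mul_assoc, mul_smul_comm, one_mul, mul_one]
  have h1 : Module.finrank ℂ (Module.End ℂ V) ≤ 1 :=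
    finrank_le_one (1 : Module.End ℂ V) fun f => (hall f).imp fun c hc => hc.symm
  have h2 : Module.finrank ℂ (Module.End ℂ V) = Module.finrank ℂ V * Module.finrank ℂ V :=
    Module.finrank_linearMap ℂ ℂ V V
  nlinarith

/-- The center of `G ⧸ ker V` is cyclic for `V` simple. -/
theorem FDRep.isCyclic_center_quotient_ker {G : Type} [Group G] [Finite G] (V : FDRep ℂ G)
    [Simple V] (hV : 1 < Module.finrank ℂ V) :
    IsCyclic (Subgroup.center (G ⧸ V.ρ.ker)) := by
  have : Nontrivial V := Module.nontrivial_of_finrank_pos (R := ℂ) (by omega)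
  let r : G ⧸ V.ρ.ker →* Module.End ℂ V := QuotientGroup.lift V.ρ.ker V.ρ fun g hg => hg
  have hsc : ∀ z : Subgroup.center (G ⧸ V.ρ.ker), ∃ c : ℂ, r z = c • 1 := fun z =>
    V.exists_smul_one_of_commute _ fun g => by
      have h := Subgroup.mem_center_iff.1 z.2 (g : G ⧸ V.ρ.ker)
      have h1 : V.ρ g = r (g : G ⧸ V.ρ.ker) := rfl
      rw [h1, ← map_mul, ← map_mul, h]
  choose c hc using hsc
  have hinj : Function.Injective fun c : ℂ => c • (1 : Module.End ℂ V) :=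
    smul_left_injective ℂ one_ne_zero
  let f : Subgroup.center (G ⧸ V.ρ.ker) →* ℂ :=
    { toFun := c
      map_one' := hinj (by
        change c 1 • (1 : Module.End ℂ V) = (1 : ℂ) • 1
        rw [← hc, Subgroup.coe_one, map_one, one_smul])
      map_mul' := fun x y => hinj (by
        change c (x * y) • (1 : Module.End ℂ V) = (c x * c y) • 1
        rw [← hc, Subgroup.coe_mul, map_mul, hc, hc, smul_mul_smul_comm, one_mul]) }
  refine isCyclic_of_injective_ringHom f fun x y hxy => ?_
  have hxy' : c x = c y := hxy
  apply Subtype.ext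
  have hr : r x = r y := by rw [hc, hc, hxy']
  obtain ⟨a, ha⟩ := QuotientGroup.mk_surjective (x : G ⧸ V.ρ.ker)
  obtain ⟨b, hb⟩ := QuotientGroup.mk_surjective (y : G ⧸ V.ρ.ker)
  rw [← ha, ← hb] at hr ⊢
  have hab : V.ρ a = V.ρ b := hr
  refine QuotientGroup.eq.2 ?_
  change V.ρ (a⁻¹ * b) = 1
  rw [map_mul, ← hab, ← map_mul, inv_mul_cancel, map_one]

namespace Representation

variable {k G W : Type*} [Field k] [Group G] [AddCommGroup W] [Module k W]

theorem isIrreducible_toRepresentation_of_isAtom {ρ : Representation k G W}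
    (S : Subrepresentation ρ) (hS : IsAtom S) : S.toRepresentation.IsIrreducible := by
  have key : ∀ τ : Subrepresentation S.toRepresentation, τ = ⊥ ∨ τ = ⊤ := by
    intro τ
    let T : Subrepresentation ρ := ⟨τ.toSubmodule.map S.toSubmodule.subtype, by
      rintro g _ ⟨v, hv, rfl⟩
      exact ⟨_, τ.apply_mem_toSubmodule g hv, rfl⟩⟩
    have hTS : T ≤ S := by
      rintro _ ⟨v, hv, rfl⟩
      exact v.2
    rcases hS.le_iff.1 hTS with h | h
    · left
      apply Subrepresentation.toSubmodule_injective
      have h' : τ.toSubmodule.map S.toSubmodule.subtype = ⊥ :=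
        congrArg Subrepresentation.toSubmodule h
      exact Submodule.map_injective_of_injective S.toSubmodule.injective_subtype
        (h'.trans (Submodule.map_bot _).symm)
    · right
      apply Subrepresentation.toSubmodule_injective
      have h' : τ.toSubmodule.map S.toSubmodule.subtype = S.toSubmodule :=
        congrArg Subrepresentation.toSubmodule h
      refine (Submodule.eq_top_iff').2 fun v => ?_
      have hv : (v : W) ∈ τ.toSubmodule.map S.toSubmodule.subtype := by
        rw [h']
        exact v.2
      obtain ⟨u, hu, huv⟩ := hv
      rwa [Subtype.ext huv] at hu
  have hne : (⊥ : Subrepresentation S.toRepresentation) ≠ ⊤ := by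
    intro h
    apply hS.1
    apply Subrepresentation.toSubmodule_injective
    have h' : (⊥ : Submodule k S.toSubmodule) = ⊤ := congrArg Subrepresentation.toSubmodule h
    refine (Submodule.eq_bot_iff _).2 fun v hv => ?_
    have : (⟨v, hv⟩ : S.toSubmodule) ∈ (⊥ : Submodule k S.toSubmodule) := h' ▸ Submodule.mem_top
    exact congrArg Subtype.val ((Submodule.mem_bot k).1 this)
  exact { exists_pair_ne := ⟨_, _, hne⟩, eq_bot_or_eq_top := key }

/-- If `ρ z ≠ 1`, some irreducible subrepresentation of `ρ` is nontrivial at `z`. -/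
theorem exists_isIrreducible_apply_ne [Finite G] [NeZero (Nat.card G : k)]
    (ρ : Representation k G W) {z : G} (hz : ρ z ≠ 1) :
    ∃ S : Subrepresentation ρ, S.toRepresentation.IsIrreducible ∧ ∃ v ∈ S, ρ z v ≠ v := by
  by_contra! H
  apply hz
  let e := Subrepresentation.subrepresentationSubmoduleOrderIso (ρ := ρ)
  have hmem : ∀ v : ρ.asModule,
      v ∈ sSup {m : Submodule (MonoidAlgebra k G) ρ.asModule |
        IsSimpleModule (MonoidAlgebra k G) m} := by
    intro v
    rw [IsSemisimpleModule.sSup_simples_eq_top]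
    trivial
  ext v
  have hv := hmem v
  rw [sSup_eq_iSup'] at hv
  refine Submodule.iSup_induction _ (motive := fun v : ρ.asModule => ρ z v = v) hv ?_
    (map_zero _) ?_
  · rintro ⟨m, hm⟩ x hx
    have hat : IsAtom (e.symm m) := (e.symm.isAtom_iff m).2 (isSimpleModule_iff_isAtom.1 hm)
    exact H (e.symm m) (isIrreducible_toRepresentation_of_isAtom _ hat) x hx
  · intro x y hx hy
    exact (map_add (ρ z) x y).trans (congrArg₂ _ hx hy)

end Representation

theorem FDRep.simple_of_isIrreducible {G W : Type} [Group G] [Finite G] [AddCommGroup W]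
    [Module ℂ W] [FiniteDimensional ℂ W] (σ : Representation ℂ G W) [σ.IsIrreducible] :
    Simple (FDRep.of σ) := by
  have := Fintype.ofFinite G
  have := invertibleOfNonzero (NeZero.ne (Nat.card G : ℂ))
  rw [FDRep.simple_iff_char_is_norm_one]
  have h := Representation.char_orthonormal σ σ
  rw [if_pos ⟨Representation.Equiv.refl σ⟩] at h
  have hne : (Nat.card G : ℂ) ≠ 0 := NeZero.ne _
  exact ((inv_mul_eq_one₀ hne).1 h).symm

/-- If a commutator lies outside the normal subgroup `M`, there is a nonlinear simple representation
trivial on `M` but not at that commutator. -/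
theorem FDRep.exists_simple_of_commutator_notMem {G : Type} [Group G] [Finite G] (M : Subgroup G)
    [M.Normal] {a b : G} (hab : ⁅a, b⁆ ∉ M) :
    ∃ V : FDRep ℂ G, Simple V ∧ 1 < Module.finrank ℂ V ∧ M ≤ V.ρ.ker ∧ ⁅a, b⁆ ∉ V.ρ.ker := by
  let ρ : Representation ℂ G (MonoidAlgebra ℂ (G ⧸ M)) := Representation.ofMulAction ℂ G (G ⧸ M)
  have hz : ρ ⁅a, b⁆ ≠ 1 := by
    intro h
    have h1 := LinearMap.congr_fun h (MonoidAlgebra.single ((1 : G) : G ⧸ M) 1)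
    have h2 : MonoidAlgebra.single (⁅a, b⁆ • ((1 : G) : G ⧸ M)) (1 : ℂ) =
        MonoidAlgebra.single ((1 : G) : G ⧸ M) 1 := by
      rw [← Representation.ofMulAction_single]
      exact h1
    have h3 := MonoidAlgebra.single_left_injective one_ne_zero h2
    apply hab
    rw [MulAction.Quotient.smul_coe, smul_eq_mul, mul_one] at h3
    exact (QuotientGroup.eq_one_iff _).1 h3
  have hM : ∀ g ∈ M, ρ g = 1 := by
    intro g hg
    apply LinearMap.toAddMonoidHom_injective
    refine MonoidAlgebra.addMonoidHom_ext fun q c => ?_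
    change ρ g (MonoidAlgebra.single q c) = MonoidAlgebra.single q c
    rw [Representation.ofMulAction_single]
    congr 1
    obtain ⟨x, rfl⟩ := QuotientGroup.mk_surjective q
    rw [MulAction.Quotient.smul_coe, smul_eq_mul]
    have : ((g * x : G) : G ⧸ M) = (g : G ⧸ M) * x := rfl
    rw [this, (QuotientGroup.eq_one_iff g).2 hg, one_mul]
  obtain ⟨S, hS, v, hv, hne⟩ := ρ.exists_isIrreducible_apply_ne hz
  have hfin : FiniteDimensional ℂ S.toSubmodule := inferInstance
  let σ : Representation ℂ G S.toSubmodule := S.toRepresentation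
  have hσ : σ.IsIrreducible := hS
  let V := FDRep.of σ
  have hVs : Simple V := FDRep.simple_of_isIrreducible σ
  have hker : ⁅a, b⁆ ∉ V.ρ.ker := by
    intro h
    have h1 : S.toRepresentation ⁅a, b⁆ = 1 := h
    exact hne (congrArg Subtype.val (LinearMap.congr_fun h1 ⟨v, hv⟩))
  refine ⟨V, hVs, ?_, ?_, hker⟩
  · by_contra! hle
    apply hker
    have hsc : ∀ f : Module.End ℂ V, ∃ c : ℂ, f = c • 1 := by
      intro f
      obtain ⟨w, hw⟩ := finrank_le_one_iff.1 hle
      obtain ⟨c, hc⟩ := hw (f w)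
      refine ⟨c, LinearMap.ext fun u => ?_⟩
      obtain ⟨d, rfl⟩ := hw u
      rw [map_smul, ← hc, LinearMap.smul_apply, Module.End.one_apply, smul_comm]
    have hcomm : V.ρ a * V.ρ b = V.ρ b * V.ρ a := by
      obtain ⟨c, hc⟩ := hsc (V.ρ a)
      rw [hc, smul_mul_assoc, mul_smul_comm, one_mul, mul_one]
    change V.ρ ⁅a, b⁆ = 1
    rw [commutatorElement_def, map_mul, map_mul, map_mul, hcomm, ← map_mul, ← map_mul, ← map_mul,
      mul_inv_cancel_right, mul_inv_cancel, map_one]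
  · intro g hg
    change S.toRepresentation g = 1
    exact LinearMap.ext fun u => Subtype.ext (LinearMap.congr_fun (hM g hg) u.1)

theorem Subgroup.commutatorElement_mem_iff_commute {G : Type*} [Group G] {N : Subgroup G}
    [N.Normal] {a b : G} : ⁅a, b⁆ ∈ N ↔ Commute (a : G ⧸ N) (b : G ⧸ N) := by
  rw [← commutatorElement_eq_one_iff_commute, ← QuotientGroup.eq_one_iff]
  rfl

theorem Subgroup.mem_centralizer_singleton_iff_commute {G : Type*} [Group G] {a b : G} :
    a ∈ Subgroup.centralizer {b} ↔ Commute a b := by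
  rw [Subgroup.mem_centralizer_singleton_iff]
  rfl

theorem Subgroup.mem_center_iff_commute {G : Type*} [Group G] {a : G} :
    a ∈ Subgroup.center G ↔ ∀ g, Commute a g := by
  rw [Subgroup.mem_center_iff]
  exact forall_congr' fun g => eq_comm

theorem Commute.of_zpow_of_zpow_prime {G : Type*} [Group G] {a b : G} {p : ℕ} (hp : p.Prime)
    {i : ℤ} (hpi : ¬ (p : ℤ) ∣ i) (h1 : Commute (a ^ p) b) (h2 : Commute (a ^ i) b) :
    Commute a b := by
  have hcop : IsCoprime (p : ℤ) i :=
    (Nat.prime_iff_prime_int.1 hp).coprime_iff_not_dvd.2 hpi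
  obtain ⟨u, v, huv⟩ := hcop
  have h : a = (a ^ p) ^ u * (a ^ i) ^ v := by
    rw [← zpow_natCast, ← zpow_mul, ← zpow_mul, ← zpow_add, mul_comm _ u, mul_comm _ v, huv,
      zpow_one]
  rw [h]
  exact (h1.zpow_left u).mul_left (h2.zpow_left v)

theorem pow_mul_eq_of_commute_commutatorElement {G : Type*} [Group G] {x y : G}
    (h : Commute ⁅x, y⁆ x) (n : ℕ) : x ^ n * y = ⁅x, y⁆ ^ n * (y * x ^ n) := by
  induction n with
  | zero => simp
  | succ n ih =>
    have h1 : x * y = ⁅x, y⁆ * (y * x) := by rw [commutatorElement_def]; group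
    calc x ^ (n + 1) * y = x ^ n * (x * y) := by rw [pow_succ, mul_assoc]
      _ = x ^ n * ⁅x, y⁆ * (y * x) := by rw [h1, ← mul_assoc]
      _ = ⁅x, y⁆ * (x ^ n * y) * x := by rw [← (h.pow_right n).eq]; simp only [mul_assoc]
      _ = ⁅x, y⁆ ^ (n + 1) * (y * x ^ (n + 1)) := by
        rw [ih, pow_succ' ⁅x, y⁆, pow_succ x]; simp only [mul_assoc]

theorem commute_pow_iff_commutatorElement_pow {G : Type*} [Group G] {x y : G}
    (h : Commute ⁅x, y⁆ x) (n : ℕ) : Commute (x ^ n) y ↔ ⁅x, y⁆ ^ n = 1 := by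
  rw [commute_iff_eq, pow_mul_eq_of_commute_commutatorElement h, mul_eq_right]

/-- The centralizer of `g` in `K` has index at most the number of commutators `⁅x, g⁆`. -/
theorem Subgroup.relIndex_centralizer_singleton_le {G : Type*} [Group G] {K N : Subgroup G}
    [Finite N] {g : G} (h : ∀ x ∈ K, ⁅x, g⁆ ∈ N) :
    (Subgroup.centralizer {g}).relIndex K ≤ Nat.card N := by
  let f : K → N := fun x => ⟨⁅(x : G), g⁆, h x x.2⟩
  let F : K ⧸ (Subgroup.centralizer {g}).subgroupOf K → N := fun q => f q.out
  refine Nat.card_le_card_of_injective F fun a b hab => ?_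
  have h1 : ⁅(a.out : G), g⁆ = ⁅(b.out : G), g⁆ := congrArg Subtype.val hab
  rw [← a.out_eq', ← b.out_eq']
  refine QuotientGroup.eq.2 ?_
  rw [Subgroup.mem_subgroupOf, Subgroup.mem_centralizer_singleton_iff]
  simp only [commutatorElement_def] at h1
  have h2 := mul_right_cancel h1
  rw [Subgroup.coe_mul, Subgroup.coe_inv]
  calc (a.out : G)⁻¹ * b.out * g
      = (a.out : G)⁻¹ * (b.out * g * (b.out : G)⁻¹) * b.out := by group
    _ = (a.out : G)⁻¹ * (a.out * g * (a.out : G)⁻¹) * b.out := by rw [h2]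
    _ = g * ((a.out : G)⁻¹ * b.out) := by group

namespace IsPGroup

variable {p : ℕ} [Fact p.Prime] {G : Type*} [Group G] [Finite G]

theorem exists_mem_center_of_normal (hG : IsPGroup p G) (M : Subgroup G) [M.Normal]
    (hM : M ≠ ⊥) : ∃ z ∈ M, z ∈ Subgroup.center G ∧ z ≠ 1 := by
  have hdvd : p ∣ Nat.card M :=
    (hG.to_subgroup M).card_eq_or_dvd.resolve_left fun h => hM (Subgroup.card_eq_one.1 h)
  have hC : IsPGroup p (ConjAct G) := hG
  have h1 : (1 : M) ∈ MulAction.fixedPoints (ConjAct G) M := fun g => smul_one g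
  obtain ⟨b, hb, hne⟩ := hC.exists_fixed_point_of_prime_dvd_card_of_fixed_point M hdvd h1
  refine ⟨b, b.2, Subgroup.mem_center_iff.2 fun g => ?_, fun h => hne (Subtype.ext h.symm)⟩
  have h2 : g * b * g⁻¹ = b := congrArg Subtype.val (hb (ConjAct.toConjAct g))
  exact mul_inv_eq_iff_eq_mul.1 h2

theorem le_center_of_normal_of_card_eq (hG : IsPGroup p G) (N : Subgroup G) [N.Normal]
    (hN : Nat.card N = p) : N ≤ Subgroup.center G := by
  have hp : p.Prime := Fact.out
  have hne : N ≠ ⊥ := by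
    rintro rfl
    rw [Subgroup.card_bot] at hN
    exact hp.one_lt.ne hN
  obtain ⟨z, hzN, hzc, hz1⟩ := hG.exists_mem_center_of_normal N hne
  intro x hx
  have : IsCyclic N := isCyclic_of_prime_card hN
  have hx' : (⟨x, hx⟩ : N) ∈ Subgroup.zpowers (⟨z, hzN⟩ : N) :=
    mem_zpowers_of_prime_card hN fun h => hz1 (congrArg Subtype.val h)
  obtain ⟨i, hi⟩ := hx'
  have : z ^ i = x := congrArg Subtype.val hi
  rw [← this]
  exact zpow_mem hzc i

theorem commute_of_card_le_sq (hG : IsPGroup p G) (hcard : Nat.card G ≤ p ^ 2) (a b : G) :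
    Commute a b := by
  have hp : p.Prime := Fact.out
  obtain ⟨n, hn⟩ := IsPGroup.iff_card.1 hG
  rw [hn] at hcard
  have hn2 := (Nat.pow_le_pow_iff_right hp.one_lt).1 hcard
  interval_cases n
  · have : Subsingleton G := (Nat.card_eq_one_iff_unique.1 (by simpa using hn)).1
    exact Subsingleton.elim _ _
  · have : IsCyclic G := isCyclic_of_prime_card (by simpa using hn)
    exact IsMulCommutative.is_comm.comm a b
  · have := IsPGroup.isMulCommutative_of_card_eq_prime_sq hn
    exact IsMulCommutative.is_comm.comm a b

/-- If every normal subgroup of order greater than `p` contains all commutators and `N` is normal of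
order `p`, then modulo `N` all commutators lie in a central subgroup of order `p`. -/
theorem exists_commutatorElement_mem_zpowers (hG : IsPGroup p G) (N : Subgroup G) [N.Normal]
    (hN : Nat.card N = p) (hNab : ∃ a b : G, ⁅a, b⁆ ∉ N)
    (hM : ∀ M : Subgroup G, M.Normal → p < Nat.card M → ∀ a b : G, ⁅a, b⁆ ∈ M) :
    ∃ z ∈ Subgroup.center (G ⧸ N), orderOf z = p ∧
      ∀ a b : G, ((⁅a, b⁆ : G) : G ⧸ N) ∈ Subgroup.zpowers z := by
  have hp : p.Prime := Fact.out
  have hQ : IsPGroup p (G ⧸ N) := hG.to_quotient N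
  obtain ⟨a, b, hab⟩ := hNab
  have : Nontrivial (G ⧸ N) := ⟨⟨_, 1, fun h => hab ((QuotientGroup.eq_one_iff _).1 h)⟩⟩
  have hnt := hQ.center_nontrivial
  have hdvd : p ∣ Nat.card (Subgroup.center (G ⧸ N)) := by
    refine (hQ.to_subgroup _).card_eq_or_dvd.resolve_left fun h => ?_
    exact (Finite.one_lt_card (α := Subgroup.center (G ⧸ N))).ne' h
  obtain ⟨z, hz⟩ := exists_prime_orderOf_dvd_card' p hdvd
  have hzo : orderOf (z : G ⧸ N) = p := by rw [Subgroup.orderOf_coe, hz]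
  refine ⟨z, z.2, hzo, fun a b => ?_⟩
  have hnorm : (Subgroup.zpowers (z : G ⧸ N)).Normal :=
    ⟨fun n hn x => by
      have hnc : n ∈ Subgroup.center (G ⧸ N) := (Subgroup.zpowers_le).2 z.2 hn
      rwa [← (Subgroup.mem_center_iff_commute.1 hnc x).eq, mul_inv_cancel_right]⟩
  have hlt : p < Nat.card ((Subgroup.zpowers (z : G ⧸ N)).comap (QuotientGroup.mk' N)) := by
    have h1 := Subgroup.card_mul_index
      ((Subgroup.zpowers (z : G ⧸ N)).comap (QuotientGroup.mk' N))
    have h2 := Subgroup.card_mul_index (Subgroup.zpowers (z : G ⧸ N))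
    rw [Subgroup.index_comap_of_surjective _ (QuotientGroup.mk'_surjective N)] at h1
    rw [Nat.card_zpowers, hzo] at h2
    have h3 := Subgroup.card_eq_card_quotient_mul_card_subgroup N
    rw [← h2, hN, ← h1] at h3
    have hpos : 0 < (Subgroup.zpowers (z : G ⧸ N)).index :=
      Nat.pos_of_ne_zero Subgroup.index_ne_zero_of_finite
    have h4 : Nat.card ((Subgroup.zpowers (z : G ⧸ N)).comap (QuotientGroup.mk' N)) = p * p := by
      apply Nat.eq_of_mul_eq_mul_right hpos
      rw [h3]; ring
    rw [h4]
    nlinarith [hp.one_lt]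
  exact hM _ (hnorm.comap _) hlt a b

end IsPGroup

namespace IsPGroup

variable {p : ℕ} [Fact p.Prime] {G : Type*} [Group G] [Finite G]

theorem exists_commutatorElement_notMem_center (hG : IsPGroup p G) (N : Subgroup G) [N.Normal]
    (hN : Nat.card N = p) (hZ : IsCyclic (Subgroup.center G))
    (hZN : IsCyclic (Subgroup.center (G ⧸ N))) (hNab : ∃ a b : G, ⁅a, b⁆ ∉ N)
    (hM : ∀ M : Subgroup G, M.Normal → p < Nat.card M → ∀ a b : G, ⁅a, b⁆ ∈ M) :
    ∃ a b : G, ⁅a, b⁆ ∉ Subgroup.center G := by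
  classical
  have hp : p.Prime := Fact.out
  have hNZ := hG.le_center_of_normal_of_card_eq N hN
  obtain ⟨z, hzc, hzp, hz⟩ := hG.exists_commutatorElement_mem_zpowers N hN hNab hM
  by_contra! hc
  have hNpow : ∀ n ∈ N, n ^ p = 1 := fun n hn => by
    have : (⟨n, hn⟩ : N) ^ p = 1 := by rw [← hN]; exact pow_card_eq_one'
    exact congrArg Subtype.val this
  have hcpow : ∀ a b : G, ⁅a, b⁆ ^ p ∈ N := fun a b => by
    obtain ⟨i, hi⟩ := Subgroup.mem_zpowers_iff.1 (hz a b)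
    rw [← QuotientGroup.eq_one_iff, QuotientGroup.mk_pow, ← hi, ← zpow_natCast, zpow_comm,
      zpow_natCast, ← hzp, pow_orderOf_eq_one, one_zpow]
  have hpowc : ∀ x y : G, ⁅x ^ p, y⁆ ∈ N := fun x y => by
    rw [Subgroup.commutatorElement_mem_iff_commute, QuotientGroup.mk_pow,
      commute_pow_iff_commutatorElement_pow]
    · exact (QuotientGroup.eq_one_iff _).2 (hcpow x y)
    · exact ((Subgroup.mem_center_iff_commute.1 (hc x y)) x).map (QuotientGroup.mk' N)
  -- elements of the center killed by `p` lie in `N`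
  have hker : ∀ c ∈ Subgroup.center G, c ^ p = 1 → c ∈ N := by
    intro c hcZ hcp
    have := Fintype.ofFinite (Subgroup.center G)
    have hle := IsCyclic.card_pow_eq_one_le (α := Subgroup.center G) hp.pos
    have : Fintype N := Fintype.ofFinite N
    let S : Finset (Subgroup.center G) := Finset.univ.image (Subgroup.inclusion hNZ)
    have hS : S.card = p := by
      rw [Finset.card_image_of_injective _ (Subgroup.inclusion_injective hNZ), Finset.card_univ,
        ← Nat.card_eq_fintype_card, hN]
    have hsub : S ⊆ ({a | a ^ p = 1} : Finset (Subgroup.center G)) := by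
      intro s hs
      obtain ⟨n, -, rfl⟩ := Finset.mem_image.1 hs
      refine Finset.mem_filter.2 ⟨Finset.mem_univ _, Subtype.ext ?_⟩
      exact hNpow n n.2
    have heq := Finset.eq_of_subset_of_card_le hsub (by rw [hS]; exact hle)
    have hmem : (⟨c, hcZ⟩ : Subgroup.center G) ∈ S := by
      rw [heq]
      exact Finset.mem_filter.2 ⟨Finset.mem_univ _, Subtype.ext hcp⟩
    obtain ⟨n, -, hn⟩ := Finset.mem_image.1 hmem
    have : (n : G) = c := congrArg Subtype.val hn
    exact this ▸ n.2
  obtain ⟨x, y, hxy⟩ := hNab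
  have hxyp : ⁅x, y⁆ ^ p ≠ 1 := fun h => hxy (hker _ (hc x y) h)
  have hxp : ¬ Commute (x ^ p) y := by
    rwa [commute_pow_iff_commutatorElement_pow (Subgroup.mem_center_iff_commute.1 (hc x y) x)]
  have hyp : ¬ Commute (y ^ p) x := by
    rw [commute_pow_iff_commutatorElement_pow (Subgroup.mem_center_iff_commute.1 (hc y x) y),
      ← commutatorElement_inv, inv_pow, inv_eq_one]
    exact hxyp
  obtain ⟨⟨k', hk'⟩, hgen⟩ := hZN.exists_generator
  obtain ⟨k, rfl⟩ := QuotientGroup.mk_surjective k'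
  have hrep : ∀ w : G, (∀ g, ⁅w, g⁆ ∈ N) → ∃ i : ℤ, ∃ n ∈ N, w = k ^ i * n := by
    intro w hw
    have hwc : (w : G ⧸ N) ∈ Subgroup.center (G ⧸ N) := by
      refine Subgroup.mem_center_iff_commute.2 fun g' => ?_
      obtain ⟨g, rfl⟩ := QuotientGroup.mk_surjective g'
      exact Subgroup.commutatorElement_mem_iff_commute.1 (hw g)
    obtain ⟨i, hi⟩ := hgen ⟨w, hwc⟩
    have hi' : ((k ^ i : G) : G ⧸ N) = w := congrArg Subtype.val hi
    exact ⟨i, (k ^ i)⁻¹ * w, QuotientGroup.eq.1 hi', by group⟩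
  have hkN : ∀ g, ⁅k, g⁆ ∈ N := fun g =>
    Subgroup.commutatorElement_mem_iff_commute.2 (Subgroup.mem_center_iff_commute.1 hk' g)
  have hkp : ∀ g, Commute (k ^ p) g := fun g => by
    rw [commute_pow_iff_commutatorElement_pow (Subgroup.mem_center_iff_commute.1 (hc k g) k)]
    exact hNpow _ (hkN g)
  obtain ⟨i, n, hn, hi⟩ := hrep _ (hpowc x)
  obtain ⟨j, m, hm, hj⟩ := hrep _ (hpowc y)
  have hncomm := Subgroup.mem_center_iff_commute.1 (hNZ hn)
  have hmcomm := Subgroup.mem_center_iff_commute.1 (hNZ hm)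
  by_cases hpi : (p : ℤ) ∣ i
  · obtain ⟨q, rfl⟩ := hpi
    apply hxp
    rw [hi, zpow_mul, zpow_natCast]
    exact ((hkp y).zpow_left q).mul_left (hncomm y)
  · have hki : Commute (k ^ i) x := by
      have : k ^ i = x ^ p * n⁻¹ := by rw [hi, mul_inv_cancel_right]
      rw [this]
      exact ((Commute.refl x).pow_left p).mul_left (hncomm x).inv_left
    have hkx := Commute.of_zpow_of_zpow_prime hp hpi (hkp x) hki
    apply hyp
    rw [hj]
    exact (hkx.zpow_left j).mul_left (hmcomm x)

theorem card_eq_pow_four_of_commutatorElement (hG : IsPGroup p G) (N : Subgroup G) [N.Normal]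
    (hN : Nat.card N = p) (hZN : IsCyclic (Subgroup.center (G ⧸ N)))
    (hNab : ∃ a b : G, ⁅a, b⁆ ∉ N) (hnc : ∃ a b : G, ⁅a, b⁆ ∉ Subgroup.center G)
    (hM : ∀ M : Subgroup G, M.Normal → p < Nat.card M → ∀ a b : G, ⁅a, b⁆ ∈ M) :
    Nat.card G = p ^ 4 := by
  have hp : p.Prime := Fact.out
  have hNZ := hG.le_center_of_normal_of_card_eq N hN
  obtain ⟨z, hzc, hzp, hz⟩ := hG.exists_commutatorElement_mem_zpowers N hN hNab hM
  obtain ⟨a₀, b₀, hab₀⟩ := hnc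
  have hZeq : Subgroup.center G = N := by
    have hle : Nat.card (Subgroup.center G) ≤ p := by
      by_contra! hlt
      exact hab₀ (hM _ inferInstance hlt a₀ b₀)
    exact (Subgroup.eq_of_le_of_card_ge hNZ (by rw [hN]; exact hle)).symm
  let K : Subgroup G := (Subgroup.center (G ⧸ N)).comap (QuotientGroup.mk' N)
  have hKmem : ∀ x, x ∈ K ↔ ∀ g, ⁅x, g⁆ ∈ N := by
    intro x
    refine Subgroup.mem_center_iff_commute.trans ⟨fun h g => ?_, fun h g' => ?_⟩
    · exact Subgroup.commutatorElement_mem_iff_commute.2 (h g)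
    · obtain ⟨g, rfl⟩ := QuotientGroup.mk_surjective g'
      exact Subgroup.commutatorElement_mem_iff_commute.1 (h g)
  have hcK : ∀ a b : G, ⁅a, b⁆ ∈ K := fun a b => by
    obtain ⟨i, hi⟩ := Subgroup.mem_zpowers_iff.1 (hz a b)
    change ((⁅a, b⁆ : G) : G ⧸ N) ∈ Subgroup.center (G ⧸ N)
    rw [← hi]
    exact zpow_mem hzc i
  obtain ⟨⟨k', hk'⟩, hgen⟩ := hZN.exists_generator
  obtain ⟨k, rfl⟩ := QuotientGroup.mk_surjective k'
  have hkK : k ∈ K := hk'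
  let C : Subgroup G := Subgroup.centralizer {k}
  have hKC : ∀ w ∈ K, ∀ c ∈ C, Commute w c := by
    intro w hw c hc
    obtain ⟨i, hi⟩ := hgen ⟨w, hw⟩
    have hi' : ((k ^ i : G) : G ⧸ N) = w := congrArg Subtype.val hi
    have hn : (k ^ i)⁻¹ * w ∈ N := QuotientGroup.eq.1 hi'
    have hw' : w = k ^ i * ((k ^ i)⁻¹ * w) := by group
    rw [hw']
    exact ((Subgroup.mem_centralizer_singleton_iff_commute.1 hc).symm.zpow_left i).mul_left
      (Subgroup.mem_center_iff_commute.1 (hNZ hn) c)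
  have hKleC : K ≤ C := fun w hw => Subgroup.mem_centralizer_singleton_iff_commute.2
    (hKC w hw k (Subgroup.mem_centralizer_singleton_iff_commute.2 (Commute.refl k)))
  have hCtop : C ≠ ⊤ := fun h => hab₀ <| Subgroup.mem_center_iff_commute.2 fun g =>
    hKC _ (hcK a₀ b₀) g (h ▸ Subgroup.mem_top g)
  obtain ⟨g, hg⟩ : ∃ g, g ∉ C := by
    by_contra! h
    exact hCtop ((Subgroup.eq_top_iff' C).2 h)
  have hCle : C.index ≤ p := by
    rw [← hN, ← Subgroup.relIndex_top_right]
    refine Subgroup.relIndex_centralizer_singleton_le fun x _ => ?_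
    rw [← commutatorElement_inv]
    exact inv_mem ((hKmem k).1 hkK x)
  have hCidx : C.index = p := by
    obtain ⟨n, hn⟩ := hG.index C
    have hn0 : n ≠ 0 := by
      rintro rfl
      exact hCtop (Subgroup.index_eq_one.1 (by simpa using hn))
    refine le_antisymm hCle ?_
    rw [hn]
    exact Nat.le_self_pow hn0 p
  have hmax : ∀ D : Subgroup G, C ≤ D → g ∈ D → D = ⊤ := by
    intro D hCD hgD
    have hdvd := Subgroup.index_dvd_of_le hCD
    rw [hCidx] at hdvd
    rcases (Nat.dvd_prime hp).1 hdvd with h | h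
    · exact Subgroup.index_eq_one.1 h
    · have h1 := Subgroup.relIndex_mul_index hCD
      rw [h, hCidx] at h1
      have h2 : C.relIndex D = 1 := Nat.eq_of_mul_eq_mul_right hp.pos (by rw [h1, one_mul])
      exact absurd (Subgroup.relIndex_eq_one.1 h2 hgD) hg
  have hcenter : ∀ x, (∀ c ∈ C, Commute x c) → Commute x g → x ∈ N := by
    intro x hxC hxg
    rw [← hZeq]
    have := hmax (Subgroup.centralizer {x})
      (fun c hc => Subgroup.mem_centralizer_singleton_iff_commute.2 (hxC c hc).symm)
      (Subgroup.mem_centralizer_singleton_iff_commute.2 hxg.symm)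
    refine Subgroup.mem_center_iff_commute.2 fun y => ?_
    exact (Subgroup.mem_centralizer_singleton_iff_commute.1 (this ▸ Subgroup.mem_top y)).symm
  have hCC : ∀ a ∈ C, ∀ b ∈ C, ⁅a, b⁆ ∈ N := by
    intro a ha b hb
    refine hcenter _ (hKC _ (hcK a b)) ?_
    have hu := hcK g a
    have hv := hcK g b
    have hua : g * a * g⁻¹ = ⁅g, a⁆ * a := by rw [commutatorElement_def]; group
    have hvb : g * b * g⁻¹ = ⁅g, b⁆ * b := by rw [commutatorElement_def]; group
    have hconj : g * ⁅a, b⁆ * g⁻¹ = ⁅a, b⁆ := by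
      have huv : Commute ⁅g, a⁆ ⁅g, b⁆ := hKC _ hu _ (hKleC hv)
      have hub : Commute ⁅g, a⁆ b := hKC _ hu _ hb
      have hva : Commute ⁅g, b⁆ a := hKC _ hv _ ha
      have huvc : Commute (⁅g, a⁆ * ⁅g, b⁆) ⁅a, b⁆ :=
        hKC _ (mul_mem hu hv) _ (hKleC (hcK a b))
      rw [conjugate_commutatorElement, hua, hvb]
      generalize ⁅g, a⁆ = u at *
      generalize ⁅g, b⁆ = v at *
      have h1 : u * a * (v * b) = u * v * (a * b) := by
        rw [mul_assoc, ← mul_assoc a, ← hva.eq]; group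
      have h2 : v * b * (u * a) = u * v * (b * a) := by
        rw [mul_assoc, ← mul_assoc b, ← hub.eq, huv.eq]; group
      calc ⁅u * a, v * b⁆ = (u * a * (v * b)) * (v * b * (u * a))⁻¹ := by
            rw [commutatorElement_def]; group
        _ = u * v * ⁅a, b⁆ * (u * v)⁻¹ := by
            rw [h1, h2, commutatorElement_def]; group
        _ = ⁅a, b⁆ := by rw [huvc.eq, mul_inv_cancel_right]
    exact (mul_inv_eq_iff_eq_mul.1 hconj).symm
  let E : Subgroup G :=
    (Subgroup.centralizer {(g : G ⧸ N)}).comap (QuotientGroup.mk' N)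
  have hEmem : ∀ x, x ∈ E ↔ ⁅x, g⁆ ∈ N := fun x =>
    Subgroup.mem_centralizer_singleton_iff_commute.trans
      Subgroup.commutatorElement_mem_iff_commute.symm
  have hEidx : E.index ≤ p := by
    rw [Subgroup.index_comap_of_surjective _ (QuotientGroup.mk'_surjective N), ← hzp,
      ← Nat.card_zpowers, ← Subgroup.relIndex_top_right]
    refine Subgroup.relIndex_centralizer_singleton_le fun x' _ => ?_
    obtain ⟨x, rfl⟩ := QuotientGroup.mk_surjective x'
    exact hz x g
  have hCEK : C ⊓ E ≤ K := by
    rintro x ⟨hxC, hxE⟩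
    let F : Subgroup G :=
      (Subgroup.centralizer {(x : G ⧸ N)}).comap (QuotientGroup.mk' N)
    have hFmem : ∀ y, y ∈ F ↔ ⁅y, x⁆ ∈ N := fun y =>
      Subgroup.mem_centralizer_singleton_iff_commute.trans
        Subgroup.commutatorElement_mem_iff_commute.symm
    have hFtop : F = ⊤ := hmax F (fun c hc => (hFmem c).2 (hCC c hc x hxC)) <| (hFmem g).2 <| by
      rw [← commutatorElement_inv]
      exact inv_mem ((hEmem x).1 hxE)
    refine (hKmem x).2 fun y => ?_
    rw [← commutatorElement_inv]
    exact inv_mem ((hFmem y).1 (hFtop ▸ Subgroup.mem_top y))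
  have hKidx : K.index ≤ p * p := calc
    K.index ≤ (C ⊓ E).index := Nat.le_of_dvd
      (Nat.pos_of_ne_zero Subgroup.index_ne_zero_of_finite) (Subgroup.index_dvd_of_le hCEK)
    _ ≤ C.index * E.index := Subgroup.index_inf_le
    _ ≤ p * p := Nat.mul_le_mul hCle hEidx
  have hKcard : Nat.card K ≤ p * p := by
    have h1 : (Subgroup.centralizer {g}).relIndex K ≤ p := by
      rw [← hN]
      exact Subgroup.relIndex_centralizer_singleton_le fun x hx => (hKmem x).1 hx g
    have h2 : Nat.card ((Subgroup.centralizer {g}).subgroupOf K) ≤ p := by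
      rw [← hN]
      refine Nat.card_le_card_of_injective
        (fun x => (⟨x.1.1, hcenter _ (hKC _ x.1.2) ?_⟩ : N)) ?_
      · exact Subgroup.mem_centralizer_singleton_iff_commute.1 x.2
      · intro x y hxy
        have : (x.1.1 : G) = y.1.1 := congrArg (fun n : N => (n : G)) hxy
        exact Subtype.ext (Subtype.ext this)
    rw [← Subgroup.card_mul_index ((Subgroup.centralizer {g}).subgroupOf K)]
    exact Nat.mul_le_mul h2 h1
  have hupper : Nat.card G ≤ p ^ 4 := by
    rw [← Subgroup.card_mul_index K]
    calc _ ≤ (p * p) * (p * p) := Nat.mul_le_mul hKcard hKidx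
      _ = p ^ 4 := by ring
  obtain ⟨n, hn⟩ := IsPGroup.iff_card.1 hG
  have hlower : ¬ n ≤ 3 := by
    intro hn3
    obtain ⟨a, b, hab⟩ := hNab
    refine hab (Subgroup.commutatorElement_mem_iff_commute.2
      ((hG.to_quotient N).commute_of_card_le_sq ?_ _ _))
    have h1 := Subgroup.card_eq_card_quotient_mul_card_subgroup N
    rw [hN, hn] at h1
    refine Nat.le_of_mul_le_mul_right ?_ hp.pos
    rw [← h1, ← pow_succ]
    exact Nat.pow_le_pow_right hp.pos hn3
  rw [hn] at hupper ⊢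
  have := (Nat.pow_le_pow_iff_right hp.one_lt).1 hupper
  rw [show n = 4 by omega]

end IsPGroup

namespace IsPGroup

variable {p : ℕ} [Fact p.Prime] {G : Type*} [Group G] [Finite G]

theorem commutatorElement_mem_of_sq_le_card (hG : IsPGroup p G) (hcard : Nat.card G = p ^ 4)
    (N : Subgroup G) [N.Normal] (hN : p ^ 2 ≤ Nat.card N) (a b : G) : ⁅a, b⁆ ∈ N := by
  have hp : p.Prime := Fact.out
  refine Subgroup.commutatorElement_mem_iff_commute.2
    ((hG.to_quotient N).commute_of_card_le_sq ?_ _ _)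
  have h1 := Subgroup.card_eq_card_quotient_mul_card_subgroup N
  refine Nat.le_of_mul_le_mul_right (c := p ^ 2) ?_ (pow_pos hp.pos 2)
  calc Nat.card (G ⧸ N) * p ^ 2 ≤ Nat.card (G ⧸ N) * Nat.card N := Nat.mul_le_mul_left _ hN
    _ = p ^ 2 * p ^ 2 := by rw [← h1, hcard]; ring

theorem card_eq_one_or_of_commutatorElement_notMem (hG : IsPGroup p G)
    (hcard : Nat.card G = p ^ 4) (N : Subgroup G) [N.Normal] {a b : G} (hab : ⁅a, b⁆ ∉ N) :
    Nat.card N = 1 ∨ Nat.card N = p := by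
  have hp : p.Prime := Fact.out
  obtain ⟨n, hn⟩ := IsPGroup.iff_card.1 (hG.to_subgroup N)
  have hn2 : n < 2 := by
    by_contra! h
    exact hab (hG.commutatorElement_mem_of_sq_le_card hcard N
      (hn ▸ Nat.pow_le_pow_right hp.pos h) a b)
  interval_cases n
  · exact Or.inl (by simpa using hn)
  · exact Or.inr (by simpa using hn)

end IsPGroup

namespace Subgroup

variable {G : Type*} [Group G]

theorem upperCentralSeries_two_eq_top_iff :
    upperCentralSeries G 2 = ⊤ ↔ ∀ a b : G, ⁅a, b⁆ ∈ center G := by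
  simp only [eq_top_iff', mem_upperCentralSeries_succ_iff (n := 1), upperCentralSeries_one]

theorem upperCentralSeries_three_eq_top_iff :
    upperCentralSeries G 3 = ⊤ ↔ ∀ a b c : G, ⁅⁅a, b⁆, c⁆ ∈ center G := by
  simp only [eq_top_iff', mem_upperCentralSeries_succ_iff (n := 2),
    mem_upperCentralSeries_succ_iff (n := 1), upperCentralSeries_one]

theorem nilpotencyClass_eq_three_iff [Group.IsNilpotent G] :
    Group.nilpotencyClass G = 3 ↔ (∃ a b : G, ⁅a, b⁆ ∉ center G) ∧
      ∀ a b c : G, ⁅⁅a, b⁆, c⁆ ∈ center G := by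
  have h2 : Group.nilpotencyClass G ≤ 2 ↔ ∀ a b : G, ⁅a, b⁆ ∈ center G := by
    rw [← upperCentralSeries_eq_top_iff_nilpotencyClass_le, upperCentralSeries_two_eq_top_iff]
  have h3 : Group.nilpotencyClass G ≤ 3 ↔ ∀ a b c : G, ⁅⁅a, b⁆, c⁆ ∈ center G := by
    rw [← upperCentralSeries_eq_top_iff_nilpotencyClass_le, upperCentralSeries_three_eq_top_iff]
  rw [← h3, show (∃ a b : G, ⁅a, b⁆ ∉ center G) ↔ ¬ Group.nilpotencyClass G ≤ 2 by
    rw [h2]; push Not; rfl]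
  omega

end Subgroup

theorem card_charKer {G : Type} [Group G] [Finite G] (V : FDRep ℂ G) :
    Nat.card (charKer V) = Nat.card V.ρ.ker := by
  rw [charKer_eq_ker]
  rfl

section

variable {p : ℕ} [Fact p.Prime] {G : Type} [Group G] [Finite G]

theorem IsPGroup.card_eq_and_commutatorElement_of_kernels (hG : IsPGroup p G)
    (h : {k : ℕ | ∃ V : FDRep ℂ G, Simple V ∧ 1 < Module.finrank ℂ V ∧
      Nat.card (charKer V) = k} = {1, p}) :
    Nat.card G = p ^ 4 ∧ (∃ a b : G, ⁅a, b⁆ ∉ Subgroup.center G) ∧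
      ∀ a b c : G, ⁅⁅a, b⁆, c⁆ ∈ Subgroup.center G := by
  have hp : p.Prime := Fact.out
  have hZ : IsCyclic (Subgroup.center G) := by
    obtain ⟨V, hVs, hVd, hVk⟩ : 1 ∈ {k : ℕ | ∃ V : FDRep ℂ G, Simple V ∧
      1 < Module.finrank ℂ V ∧ Nat.card (charKer V) = k} := by rw [h]; simp
    have hc := FDRep.isCyclic_center_quotient_ker V hVd
    have hbot : V.ρ.ker = ⊥ := Subgroup.card_eq_one.1 (by rw [← card_charKer, hVk])
    let e : G ⧸ V.ρ.ker ≃* G := (QuotientGroup.quotientMulEquivOfEq hbot).trans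
      QuotientGroup.quotientBot
    exact isCyclic_of_surjective (Subgroup.centerCongr e) (Subgroup.centerCongr e).surjective
  obtain ⟨V, hVs, hVd, hVk⟩ : p ∈ {k : ℕ | ∃ V : FDRep ℂ G, Simple V ∧
      1 < Module.finrank ℂ V ∧ Nat.card (charKer V) = k} := by rw [h]; simp
  rw [card_charKer] at hVk
  have hab := FDRep.exists_commutator_notMem_ker V hVd
  have hZN := FDRep.isCyclic_center_quotient_ker V hVd
  have hM : ∀ M : Subgroup G, M.Normal → p < Nat.card M → ∀ a b : G, ⁅a, b⁆ ∈ M := by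
    intro M _ hMp a b
    by_contra habM
    obtain ⟨W, hWs, hWd, hMW, -⟩ := FDRep.exists_simple_of_commutator_notMem M habM
    have hW : Nat.card (charKer W) ∈ ({1, p} : Set ℕ) := h ▸ ⟨W, hWs, hWd, rfl⟩
    rw [card_charKer] at hW
    have hle := Subgroup.card_le_of_le hMW
    have := hp.one_lt
    rcases hW with hW | hW
    · omega
    · have : Nat.card W.ρ.ker = p := hW
      omega
  have hnc := hG.exists_commutatorElement_notMem_center V.ρ.ker hVk hZ hZN hab hM
  refine ⟨hG.card_eq_pow_four_of_commutatorElement V.ρ.ker hVk hZN hab hnc hM, hnc,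
    fun a b c => ?_⟩
  obtain ⟨z, hzc, -, hz⟩ := hG.exists_commutatorElement_mem_zpowers V.ρ.ker hVk hab hM
  refine hG.le_center_of_normal_of_card_eq V.ρ.ker hVk ?_
  rw [Subgroup.commutatorElement_mem_iff_commute]
  exact Subgroup.mem_center_iff_commute.1 ((Subgroup.zpowers_le).2 hzc (hz a b)) _

theorem IsPGroup.kernels_eq_of_card_eq (hG : IsPGroup p G) (hcard : Nat.card G = p ^ 4)
    (hnc : ∃ a b : G, ⁅a, b⁆ ∉ Subgroup.center G)
    (hc3 : ∀ a b c : G, ⁅⁅a, b⁆, c⁆ ∈ Subgroup.center G) :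
    {k : ℕ | ∃ V : FDRep ℂ G, Simple V ∧ 1 < Module.finrank ℂ V ∧
      Nat.card (charKer V) = k} = {1, p} := by
  have hp : p.Prime := Fact.out
  have hker : ∀ V : FDRep ℂ G, Simple V → 1 < Module.finrank ℂ V →
      Nat.card V.ρ.ker = 1 ∨ Nat.card V.ρ.ker = p := fun V _ hV => by
    obtain ⟨a, b, hab⟩ := FDRep.exists_commutator_notMem_ker V hV
    exact hG.card_eq_one_or_of_commutatorElement_notMem hcard _ hab
  obtain ⟨a, b, hab⟩ := hnc
  obtain ⟨c, hc⟩ : ∃ c : G, ⁅⁅a, b⁆, c⁆ ≠ 1 := by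
    by_contra! h
    exact hab (Subgroup.mem_center_iff_commute.2 fun c => commutatorElement_eq_one_iff_commute.1
      (h c))
  have hZ : Nat.card (Subgroup.center G) ≠ 1 := fun h =>
    hc (Subgroup.mem_bot.1 (Subgroup.card_eq_one.1 h ▸ hc3 a b c))
  refine Set.Subset.antisymm ?_ ?_
  · rintro k ⟨V, hVs, hVd, rfl⟩
    rw [card_charKer]
    exact hker V hVs hVd
  · rintro k (rfl | hk)
    · obtain ⟨V, hVs, hVd, -, hV⟩ := FDRep.exists_simple_of_commutator_notMem
        (⊥ : Subgroup G) (a := ⁅a, b⁆) (b := c) (by rwa [Subgroup.mem_bot])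
      refine ⟨V, hVs, hVd, ?_⟩
      rw [card_charKer]
      refine (hker V hVs hVd).resolve_right fun hVp => hV ?_
      have hle := hG.le_center_of_normal_of_card_eq V.ρ.ker hVp
      have hZp := (hG.card_eq_one_or_of_commutatorElement_notMem hcard _ hab).resolve_left hZ
      rw [Subgroup.eq_of_le_of_card_ge hle (by rw [hZp, hVp])]
      exact hc3 a b c
    · obtain ⟨V, hVs, hVd, hle, -⟩ := FDRep.exists_simple_of_commutator_notMem _ hab
      refine ⟨V, hVs, hVd, ?_⟩
      rw [card_charKer, show k = p from hk]
      refine (hker V hVs hVd).resolve_left fun h1 => hZ ?_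
      have h2 := Subgroup.card_le_of_le hle
      have h3 : 0 < Nat.card (Subgroup.center G) := Nat.card_pos
      omega

end

/-- For a non-Abelian finite `p`-group `G` (`p` odd), `skn(G) = {1, p}` iff `G` has order
`p ^ 4` and nilpotency class `3` (i.e. `G` is of maximal class). -/
theorem skn_eq_one_p_iff (p : ℕ) (hp : p.Prime) (hodd : Odd p)
    (G : Type) [Group G] [Fintype G] (hpG : IsPGroup p G)
    (hnab : ¬ ∀ a b : G, a * b = b * a) :
    {k : ℕ | ∃ V : FDRep ℂ G, Simple V ∧ 1 < Module.finrank ℂ V ∧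
        Nat.card (charKer V) = k} = {1, p} ↔
      (Nat.card G = p ^ 4 ∧
        (letI : Fact p.Prime := ⟨hp⟩; letI := hpG.isNilpotent;
          Group.nilpotencyClass G = 3)) := by
  have : Fact p.Prime := ⟨hp⟩
  have := hpG.isNilpotent
  rw [Subgroup.nilpotencyClass_eq_three_iff]
  exact ⟨hpG.card_eq_and_commutatorElement_of_kernels,
    fun h => hpG.kernels_eq_of_card_eq h.1 h.2.1 h.2.2⟩
end

section
/- Let G be a finite group such that (G, Z(G)) is a generalized Camina pair. Then the set of degrees of the irreducible complex characters of G is {1, (|G|/|Z(G)|)^{1/2}}. -/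
open CategoryTheory

open MonoidAlgebra

/-- An irreducible complex representation of a finite group is a simple object of `FDRep`. -/
theorem FDRep.simple_of_isIrreducible_s17 {G : Type} [Group G] [Fintype G] {V : Type} [AddCommGroup V]
    [Module ℂ V] [Module.Finite ℂ V] (ρ : Representation ℂ G V) [ρ.IsIrreducible] :
    Simple (FDRep.of ρ) := by
  rw [FDRep.simple_iff_char_is_norm_one]
  have hc : (Nat.card G : ℂ) ≠ 0 := NeZero.ne _
  have := invertibleOfNonzero hc
  have h := Representation.char_orthonormal ρ ρ
  rw [if_pos ⟨Representation.Equiv.refl ρ⟩] at h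
  rw [inv_mul_eq_one₀ hc] at h
  exact h.symm

/-- Endomorphisms of a vector space of dimension at most one commute. -/
theorem Module.End.commute_of_finrank_le_one {K V : Type*} [Field K] [AddCommGroup V] [Module K V]
    [Module.Finite K V] (h : Module.finrank K V ≤ 1) (f g : Module.End K V) : f * g = g * f := by
  obtain ⟨v, hv⟩ := finrank_le_one_iff.mp h
  obtain ⟨a, ha⟩ := hv (f v)
  obtain ⟨b, hb⟩ := hv (g v)
  ext w
  obtain ⟨c, rfl⟩ := hv w
  simp [← ha, ← hb, smul_smul, mul_comm, mul_left_comm]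

/-- The representation on a simple module over the group algebra is irreducible. -/
theorem Representation.isIrreducible_ofModule' {K G M : Type*} [Field K] [Group G]
    [AddCommGroup M] [Module K M] [Module K[G] M] [IsScalarTower K K[G] M]
    [IsSimpleModule K[G] M] : (Representation.ofModule' (k := K) (G := G) M).IsIrreducible := by
  rw [Representation.irreducible_iff_isSimpleModule_asModule]
  let ρ : Representation K G M := Representation.ofModule' M
  have hρ : ρ.asAlgebraHom = Algebra.lsmul K K M :=
    (MonoidAlgebra.lift K (Module.End K M) G).apply_symm_apply (Algebra.lsmul K K M)
  let e : ρ.asModule ≃ₗ[K[G]] M :=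
    { ρ.asModuleEquiv.toAddEquiv with
      map_smul' := fun r x => by
        refine (ρ.asModuleEquiv_map_smul r x).trans ?_
        rw [hρ]
        rfl }
  exact IsSimpleModule.congr e

/-- If every simple complex representation of a finite group `G` has dimension at most one,
then `g * k` and `k * g` act equally on every simple `ℂ[G]`-module. -/
theorem smul_mul_comm_of_forall_finrank_le_one {G : Type} [Group G] [Fintype G]
    (h : ∀ V : FDRep ℂ G, Simple V → Module.finrank ℂ V ≤ 1) (M : Type) [AddCommGroup M]
    [Module ℂ M] [Module ℂ[G] M] [IsScalarTower ℂ ℂ[G] M] [IsSimpleModule ℂ[G] M]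
    (g k : G) (m : M) : of ℂ G (g * k) • m = of ℂ G (k * g) • m := by
  have : Module.Finite ℂ M := Module.Finite.trans ℂ[G] M
  let ρ : Representation ℂ G M := Representation.ofModule' M
  have : ρ.IsIrreducible := Representation.isIrreducible_ofModule'
  have hle : Module.finrank ℂ M ≤ 1 := h _ (FDRep.simple_of_isIrreducible_s17 ρ)
  have hcomm := Module.End.commute_of_finrank_le_one hle (ρ g) (ρ k)
  rw [← map_mul, ← map_mul] at hcomm
  exact LinearMap.congr_fun hcomm m

/-- If every simple complex representation of a finite group has dimension at most one,
then the group is abelian. -/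
theorem mul_comm_of_forall_finrank_le_one {G : Type} [Group G] [Fintype G]
    (h : ∀ V : FDRep ℂ G, Simple V → Module.finrank ℂ V ≤ 1) (g k : G) : g * k = k * g := by
  have hann : (of ℂ G (g * k) - of ℂ G (k * g) : ℂ[G]) ∈ Module.annihilator ℂ[G] ℂ[G] := by
    rw [← Submodule.annihilator_top, ← IsSemisimpleModule.sSup_simples_eq_top, sSup_eq_iSup',
      Submodule.annihilator_iSup, Submodule.mem_iInf]
    rintro ⟨S, hS : IsSimpleModule ℂ[G] S⟩
    rw [Submodule.mem_annihilator]
    intro s hs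
    rw [sub_smul, sub_eq_zero]
    exact congrArg Subtype.val (smul_mul_comm_of_forall_finrank_le_one h S g k ⟨s, hs⟩)
  rw [Module.mem_annihilator] at hann
  have := hann 1
  rw [smul_eq_mul, mul_one, sub_eq_zero] at this
  exact of_injective this

/-- A central element acts on a simple representation by a scalar. -/
theorem FDRep.exists_smul_of_mem_center {G : Type} [Group G] [Fintype G] (V : FDRep ℂ G) [Simple V]
    {z : G} (hz : z ∈ Subgroup.center G) : ∃ c : ℂ, V.ρ z = c • LinearMap.id := by
  let f : V ⟶ V := ⟨Action.ρ V z, fun g => by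
    have := congrArg (Action.ρ V) (Subgroup.mem_center_iff.mp hz g)
    rw [map_mul, map_mul] at this
    exact this.symm⟩
  have h1 := finrank_endomorphism_simple_eq_one ℂ V
  obtain ⟨c, hc⟩ := (finrank_eq_one_iff_of_nonzero' (𝟙 V) (id_nonzero V)).mp h1 f
  refine ⟨c, ?_⟩
  have := congrArg (fun φ : V ⟶ V => φ.hom.hom.hom) hc
  exact this.symm

theorem FDRep.character_mul_character_inv_of_mem_center {G : Type} [Group G] [Fintype G]
    (V : FDRep ℂ G) [Simple V] {z : G} (hz : z ∈ Subgroup.center G) :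
    V.character z * V.character z⁻¹ = (Module.finrank ℂ V : ℂ) ^ 2 := by
  obtain ⟨a, ha⟩ := V.exists_smul_of_mem_center hz
  obtain ⟨b, hb⟩ := V.exists_smul_of_mem_center (inv_mem hz)
  have hab : V.ρ z * V.ρ z⁻¹ = 1 := by rw [← map_mul, mul_inv_cancel, map_one]
  have htr := congrArg (LinearMap.trace ℂ V) hab
  rw [ha, hb, smul_mul_smul_comm] at htr
  simp only [← Module.End.one_eq_id, mul_one, map_smul, LinearMap.trace_one, smul_eq_mul] at htr
  simp only [FDRep.character, ha, hb, ← Module.End.one_eq_id, map_smul,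
    LinearMap.trace_one, smul_eq_mul]
  linear_combination (Module.finrank ℂ V : ℂ) * htr

/-- A simple representation whose character vanishes off the center has degree
`(|G| / |Z(G)|)^{1/2}`. -/
theorem FDRep.finrank_sq_mul_card_center {G : Type} [Group G] [Fintype G] (V : FDRep ℂ G)
    [Simple V] (h : ∀ g : G, g ∉ Subgroup.center G → V.character g = 0) :
    Module.finrank ℂ V ^ 2 * Nat.card (Subgroup.center G) = Nat.card G := by
  classical
  have hnorm := (FDRep.simple_iff_char_is_norm_one V).mp inferInstance
  have hterm : ∀ g : G, V.character g * V.character g⁻¹ =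
      if g ∈ Subgroup.center G then (Module.finrank ℂ V : ℂ) ^ 2 else 0 := fun g => by
    split_ifs with hg
    · exact V.character_mul_character_inv_of_mem_center hg
    · rw [h g hg, zero_mul]
  simp_rw [hterm] at hnorm
  rw [← Finset.sum_filter, Finset.sum_const, nsmul_eq_mul, ← Fintype.card_subtype,
    ← Nat.card_eq_fintype_card, mul_comm] at hnorm
  exact_mod_cast hnorm

theorem FDRep.finrank_pos_of_simple {G : Type} [Group G] [Fintype G] (V : FDRep ℂ G) [Simple V] :
    0 < Module.finrank ℂ V := by
  have hnorm := (FDRep.simple_iff_char_is_norm_one V).mp inferInstance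
  by_contra! h0
  have : Subsingleton V := Module.finrank_zero_iff.mp (Nat.le_zero.mp h0)
  have hχ : ∀ g, V.character g = 0 := fun g => by
    rw [FDRep.character, Subsingleton.elim (V.ρ g) 0, map_zero]
  simp only [hχ, mul_zero, Finset.sum_const_zero] at hnorm
  exact NeZero.ne (Nat.card G : ℂ) hnorm.symm

theorem FDRep.exists_simple_finrank_eq_one (G : Type) [Group G] [Fintype G] :
    ∃ V : FDRep ℂ G, Simple V ∧ Module.finrank ℂ V = 1 := by
  refine ⟨FDRep.of (Representation.trivial ℂ G ℂ), ?_, Module.finrank_self ℂ⟩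
  rw [FDRep.simple_iff_char_is_norm_one]
  have hχ : ∀ g, (FDRep.of (Representation.trivial ℂ G ℂ)).character g = 1 := fun g =>
    (LinearMap.trace_one ℂ ℂ).trans (by simp)
  simp [hχ]

/-- Let `G` be a finite group such that `(G, Z(G))` is a generalized Camina pair. Then
`cd(G) = {1, (|G| / |Z(G)|)^{1/2}}`. -/
theorem cd_of_gcp_center (G : Type) [Group G] [Fintype G]
    (hgcp : ∀ V : FDRep ℂ G, Simple V → 1 < Module.finrank ℂ V →
      ∀ g : G, g ∉ Subgroup.center G → V.character g = 0) :
    ∃ d : ℕ, d ^ 2 * Nat.card (Subgroup.center G) = Nat.card G ∧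
      {n : ℕ | ∃ V : FDRep ℂ G, Simple V ∧ Module.finrank ℂ V = n} = {1, d} := by
  by_cases hlin : ∀ V : FDRep ℂ G, Simple V → Module.finrank ℂ V ≤ 1
  · have hcenter : Subgroup.center G = ⊤ := eq_top_iff.mpr fun g _ =>
      Subgroup.mem_center_iff.mpr fun k => mul_comm_of_forall_finrank_le_one hlin k g
    refine ⟨1, by rw [hcenter, Subgroup.card_top, one_pow, one_mul], ?_⟩
    ext n
    simp only [Set.mem_ofPred_eq, Set.mem_insert_iff, Set.mem_singleton_iff, or_self]
    constructor
    · rintro ⟨V, hV, rfl⟩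
      exact le_antisymm (hlin V hV) V.finrank_pos_of_simple
    · rintro rfl
      exact FDRep.exists_simple_finrank_eq_one G
  · push Not at hlin
    obtain ⟨W, hW, hW1⟩ := hlin
    have hcard := W.finrank_sq_mul_card_center (hgcp W hW hW1)
    refine ⟨Module.finrank ℂ W, hcard, ?_⟩
    ext n
    simp only [Set.mem_ofPred_eq, Set.mem_insert_iff, Set.mem_singleton_iff]
    constructor
    · rintro ⟨V, hV, rfl⟩
      rcases (Nat.one_le_iff_ne_zero.mpr V.finrank_pos_of_simple.ne').eq_or_lt with h | h
      · exact Or.inl h.symm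
      · have hVcard := V.finrank_sq_mul_card_center (hgcp V hV h)
        exact Or.inr (Nat.pow_left_injective two_ne_zero
          (Nat.eq_of_mul_eq_mul_right Nat.card_pos (hVcard.trans hcard.symm)))
    · rintro (rfl | rfl)
      · exact FDRep.exists_simple_finrank_eq_one G
      · exact ⟨W, hW, rfl⟩
end
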